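/- Strong solution at good points: let c satisfy the paper's Assumptions 2.1–2.3 and 2.5, set c̃(x,y) := c(x+y,y), let v₀ be nondecreasing and 1-Lipschitz, and define the limiting current v(x,t) := sup_{q∈ℝ} { v₀(q) − g^q(x−q,t) } for (x,t) ∈ ℝ × (0,∞). Then at every point (x,t) at which v is differentiable and the map (x,t) ↦ c̃(x, −v(x,t)) is continuous, one has v_t(x,t) + c̃(x, −v(x,t)) · v_x(x,t)·(1 − v_x(x,t)) = 0. If in addition every non-vertical discontinuity curve h of c̃ satisfies h′(s) ∉ [−1,0] for a.e. s (the paper's Assumption 2.10), then almost every (x,t) ∈ ℝ × (0,∞) is such a point, so v is an almost-everywhere classical solution of v_t + c̃(x,−v) v_x (1−v_x) = 0. -/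

import Mathlib

open MeasureTheory

/-- `ψ(y)`: the negative Legendre dual of the TASEP flux, given piecewise. -/
noncomputable def psi (y : ℝ) : ℝ :=
  if y < -1 then -y else if y ≤ 1 then (1 - y) ^ 2 / 4 else 0

/-- The homogeneous exponential last-passage shape function `γ(x,y) = (√x + √y)²`. -/
noncomputable def gam (x y : ℝ) : ℝ := (Real.sqrt x + Real.sqrt y) ^ 2

/-- The lower wedge boundary `β(x) = max(0, −x)`. -/
def beta (x : ℝ) : ℝ := max 0 (-x)

/-- A speed function: Borel measurable, strictly positive, and on every compact set
bounded above and bounded below away from `0`. -/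
def SpeedFunction (c : ℝ × ℝ → ℝ) : Prop :=
  Measurable c ∧ (∀ z, 0 < c z) ∧
    ∀ K : Set (ℝ × ℝ), IsCompact K →
      ∃ m M : ℝ, 0 < m ∧ ∀ z ∈ K, m ≤ c z ∧ c z ≤ M

/-- An admissible macroscopic path from `A` to `B`: continuous on `[0,1]`, piecewise `C¹`
(differentiable off a finite set), with nonnegative derivative components. -/
structure AdmissiblePath (A B : ℝ × ℝ) where
  p : ℝ → ℝ × ℝ
  cont : ContinuousOn p (Set.Icc 0 1)
  init : p 0 = A
  ep : p 1 = B
  pw : ∃ T : Finset ℝ, ∀ s ∈ Set.Ioo (0 : ℝ) 1, s ∉ T →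
    DifferentiableAt ℝ p s ∧ 0 ≤ (deriv p s).1 ∧ 0 ≤ (deriv p s).2

/-- The weight `∫₀¹ γ(x₁′(s), x₂′(s)) / c(x(s)) ds` collected by a path. -/
noncomputable def pathWeight (c : ℝ × ℝ → ℝ) (p : ℝ → ℝ × ℝ) : ℝ :=
  ∫ s in (0 : ℝ)..1, gam (deriv p s).1 (deriv p s).2 / c (p s)

/-- The macroscopic two-point last-passage value `Γ_c(A,B)`, a supremum over admissible
paths from `A` to `B`. -/
noncomputable def Gamma (c : ℝ × ℝ → ℝ) (A B : ℝ × ℝ) : ℝ :=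
  sSup { w : ℝ | ∃ P : AdmissiblePath A B, w = pathWeight c P.p }

/-- The `q`-shifted shape function
`Γ_c^q(x,y) = Γ_c((q − v₀(q), −v₀(q)), (x + q − v₀(q), y − v₀(q)))`. -/
noncomputable def GammaQ (c : ℝ × ℝ → ℝ) (v₀ : ℝ → ℝ) (q x y : ℝ) : ℝ :=
  Gamma c (q - v₀ q, -v₀ q) (x + q - v₀ q, y - v₀ q)

/-- The level curve `g^q(x,t) = inf{ y ≥ β(x) : Γ_c^q(x+y, y) ≥ t }`. -/
noncomputable def levelCurve (c : ℝ × ℝ → ℝ) (v₀ : ℝ → ℝ) (q x t : ℝ) : ℝ :=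
  sInf { y : ℝ | beta x ≤ y ∧ t ≤ GammaQ c v₀ q (x + y) y }

/-- A strictly monotone `C¹` graph curve (a discontinuity curve of the speed function). -/
structure MonoCurve where
  a : ℝ
  b : ℝ
  hab : a < b
  f : ℝ → ℝ
  smooth : ContDiffOn ℝ 1 f (Set.Icc a b)
  mono : StrictMonoOn f (Set.Icc a b) ∨ StrictAntiOn f (Set.Icc a b)

/-- The graph of a monotone curve, as a subset of the plane. -/
def MonoCurve.graph (h : MonoCurve) : Set (ℝ × ℝ) :=
  {p : ℝ × ℝ | p.1 ∈ Set.Icc h.a h.b ∧ p.2 = h.f p.1}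

/-- The paper's Assumptions 2.1–2.3 on the LPP speed function `c`. -/
def SpeedAssumptions (c : ℝ × ℝ → ℝ) : Prop :=
  LowerSemicontinuous c ∧ (∀ z, 0 < c z) ∧
  (∀ K : Set (ℝ × ℝ), IsCompact K →
    ∃ m M : ℝ, 0 < m ∧ ∀ z ∈ K, m ≤ c z ∧ c z ≤ M) ∧
  ∃ (ι : Type) (_ : Countable ι) (h : ι → MonoCurve),
    (∀ z : ℝ × ℝ, z ∉ ⋃ i, (h i).graph → ContinuousAt c z) ∧
    (∀ K : Set (ℝ × ℝ), IsCompact K → {i : ι | ((h i).graph ∩ K).Nonempty}.Finite) ∧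
    (∀ i : ι, ∀ p ∈ (h i).graph,
      Filter.Tendsto c (nhdsWithin p {z : ℝ × ℝ | z.2 < (h i).f z.1}) (nhds (c p)) ∨
      Filter.Tendsto c (nhdsWithin p {z : ℝ × ℝ | (h i).f z.1 < z.2}) (nhds (c p)))

/-- The paper's Assumption 2.5: sublogarithmic growth of the speed function at infinity,
uniformly over sup-norm boxes centred at any fixed point `a`. -/
def SublogGrowth (c : ℝ × ℝ → ℝ) : Prop :=
  ∀ a : ℝ × ℝ, Filter.Tendsto
    (fun r : ℝ =>
      sSup (c '' {u : ℝ × ℝ | max |u.1 - a.1| |u.2 - a.2| ≤ r}) / Real.log r)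
    Filter.atTop (nhds 0)

/-- The paper's Assumption 2.10 phrased for the TASEP speed function `c̃`: locally, the
discontinuity set is covered by finitely many `C¹` graphs with slope a.e. outside
`[−1,0]`, finitely many vertical lines, and a countable set. -/
def Assumption210 (ct : ℝ × ℝ → ℝ) : Prop :=
  ∀ K : Set (ℝ × ℝ), IsCompact K →
    ∃ (n : ℕ) (aa bb : Fin n → ℝ) (f : Fin n → ℝ → ℝ)
      (m : ℕ) (xs ya yb : Fin m → ℝ) (P : Set (ℝ × ℝ)),
      (∀ i, ContDiffOn ℝ 1 (f i) (Set.Icc (aa i) (bb i))) ∧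
      (∀ i, ∀ᵐ s ∂volume, s ∈ Set.Ioo (aa i) (bb i) →
        deriv (f i) s ∉ Set.Icc (-1 : ℝ) 0) ∧
      P.Countable ∧
      {z : ℝ × ℝ | z ∈ K ∧ ¬ ContinuousAt ct z} ⊆
        (⋃ i, {p : ℝ × ℝ | p.1 ∈ Set.Icc (aa i) (bb i) ∧ p.2 = f i p.1}) ∪
        (⋃ j, {p : ℝ × ℝ | p.1 = xs j ∧ p.2 ∈ Set.Icc (ya j) (yb j)}) ∪ P

/-- The hydrodynamic limit `v(x,t) = sup_q { v₀(q) − g^q(x−q,t) }`. -/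
noncomputable def hydroV (c : ℝ × ℝ → ℝ) (v₀ : ℝ → ℝ) (y s : ℝ) : ℝ :=
  ⨆ q : ℝ, (v₀ q - levelCurve c v₀ q (y - q) s)

open Set Filter Topology

lemma gam_nonneg (u v : ℝ) : 0 ≤ gam u v := sq_nonneg _

lemma gam_lin {l u v : ℝ} (hl : 0 < l) (hl1 : l < 1) (hu : 0 ≤ u) (hv : 0 ≤ v) :
    gam u v ≤ u / l + v / (1 - l) := by
  unfold gam
  have h1 : 0 < 1 - l := by linarith
  have ha := Real.sq_sqrt hu
  have hb := Real.sq_sqrt hv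
  set a := Real.sqrt u
  set b := Real.sqrt v
  rw [← ha, ← hb, div_add_div _ _ hl.ne' h1.ne', le_div_iff₀ (by positivity)]
  nlinarith [sq_nonneg ((1 - l) * a - l * b)]

lemma gam_smul {k : ℝ} (hk : 0 ≤ k) (u v : ℝ) : gam (k * u) (k * v) = k * gam u v := by
  unfold gam
  rw [Real.sqrt_mul hk, Real.sqrt_mul hk, ← mul_add, mul_pow, Real.sq_sqrt hk]

lemma mono_fin (f : ℝ → ℝ) (T : Finset ℝ) : ∀ a b : ℝ, a ≤ b → ContinuousOn f (Icc a b) →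
    (∀ s ∈ Ioo a b, s ∉ T → DifferentiableAt ℝ f s ∧ 0 ≤ deriv f s) → f a ≤ f b := by
  induction T using Finset.induction_on with
  | empty =>
    intro a b hab hc hd
    have := monotoneOn_of_deriv_nonneg (convex_Icc a b) hc
      (by rw [interior_Icc]; exact fun s hs => (hd s hs (by simp)).1.differentiableWithinAt)
      (by rw [interior_Icc]; exact fun s hs => (hd s hs (by simp)).2)
    exact this (left_mem_Icc.2 hab) (right_mem_Icc.2 hab) hab
  | insert t T _ ih =>
    intro a b hab hc hd
    by_cases ht : t ∈ Ioo a b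
    · refine (ih a t ht.1.le (hc.mono (Icc_subset_Icc le_rfl ht.2.le)) ?_).trans
        (ih t b ht.2.le (hc.mono (Icc_subset_Icc ht.1.le le_rfl)) ?_)
      · intro s hs hsT
        exact hd s ⟨hs.1, hs.2.trans ht.2⟩ (by simp [hsT, hs.2.ne])
      · intro s hs hsT
        exact hd s ⟨ht.1.trans hs.1, hs.2⟩ (by simp [hsT, hs.1.ne'])
    · refine ih a b hab hc fun s hs hsT => hd s hs ?_
      have : s ≠ t := fun h => ht (h ▸ hs)
      simp [hsT, this]

lemma deriv_fst' {p : ℝ → ℝ × ℝ} {s : ℝ} (h : DifferentiableAt ℝ p s) :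
    deriv (fun s => (p s).1) s = (deriv p s).1 :=
  ((hasFDerivAt_fst (𝕜 := ℝ) (p := p s)).comp_hasDerivAt s h.hasDerivAt).deriv

lemma deriv_snd' {p : ℝ → ℝ × ℝ} {s : ℝ} (h : DifferentiableAt ℝ p s) :
    deriv (fun s => (p s).2) s = (deriv p s).2 :=
  ((hasFDerivAt_snd (𝕜 := ℝ) (p := p s)).comp_hasDerivAt s h.hasDerivAt).deriv

lemma path_mono1 {A B : ℝ × ℝ} (P : AdmissiblePath A B) :
    MonotoneOn (fun s => (P.p s).1) (Icc 0 1) := by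
  obtain ⟨T, hT⟩ := P.pw
  intro a ha b hb hab
  refine mono_fin (fun s => (P.p s).1) T a b hab
    (continuous_fst.comp_continuousOn (P.cont.mono (Icc_subset_Icc ha.1 hb.2))) ?_
  intro s hs hsT
  have := hT s ⟨ha.1.trans_lt hs.1, hs.2.trans_le hb.2⟩ hsT
  exact ⟨this.1.fst, by rw [deriv_fst' this.1]; exact this.2.1⟩

lemma path_mono2 {A B : ℝ × ℝ} (P : AdmissiblePath A B) :
    MonotoneOn (fun s => (P.p s).2) (Icc 0 1) := by
  obtain ⟨T, hT⟩ := P.pw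
  intro a ha b hb hab
  refine mono_fin (fun s => (P.p s).2) T a b hab
    (continuous_snd.comp_continuousOn (P.cont.mono (Icc_subset_Icc ha.1 hb.2))) ?_
  intro s hs hsT
  have := hT s ⟨ha.1.trans_lt hs.1, hs.2.trans_le hb.2⟩ hsT
  exact ⟨this.1.snd, by rw [deriv_snd' this.1]; exact this.2.2⟩

lemma path_ae {A B : ℝ × ℝ} (P : AdmissiblePath A B) :
    ∀ᵐ s ∂(volume.restrict (Ioc (0:ℝ) 1)),
      s ∈ Ioo (0:ℝ) 1 ∧ deriv (fun s => (P.p s).1) s = (deriv P.p s).1 ∧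
      deriv (fun s => (P.p s).2) s = (deriv P.p s).2 ∧
      0 ≤ (deriv P.p s).1 ∧ 0 ≤ (deriv P.p s).2 := by
  obtain ⟨T, hT⟩ := P.pw
  rw [ae_restrict_iff' measurableSet_Ioc]
  have h1 : ∀ᵐ s : ℝ, s ∉ ((insert 1 T : Finset ℝ) : Set ℝ) :=
    measure_eq_zero_iff_ae_notMem.1 ((Finset.finite_toSet _).measure_zero _)
  filter_upwards [h1] with s hs hs01
  simp only [Finset.coe_insert, mem_insert_iff, not_or] at hs
  have h0 : s ∈ Ioo (0:ℝ) 1 := ⟨hs01.1, lt_of_le_of_ne hs01.2 hs.1⟩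
  have := hT s h0 hs.2
  exact ⟨h0, deriv_fst' this.1, deriv_snd' this.1, this.2⟩

lemma path_intble {c : ℝ × ℝ → ℝ} (hcm : Measurable c) {A B : ℝ × ℝ} (P : AdmissiblePath A B)
    {σ m : ℝ} (h0 : 0 ≤ σ) (h1 : σ ≤ 1) (hm : 0 < m)
    (hlow : ∀ s ∈ Icc σ 1, m ≤ c (P.p s)) :
    IntervalIntegrable (fun s => gam (deriv P.p s).1 (deriv P.p s).2 / c (P.p s)) volume σ 1 ∧
    ∀ l : ℝ, 0 < l → l < 1 →
    ∫ s in σ..1, gam (deriv P.p s).1 (deriv P.p s).2 / c (P.p s) ≤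
      ((B.1 - (P.p σ).1) / l + (B.2 - (P.p σ).2) / (1 - l)) / m := by
  have hsub : Icc σ 1 ⊆ Icc 0 1 := Icc_subset_Icc h0 le_rfl
  have hm1 : MonotoneOn (fun s => (P.p s).1) (uIcc σ 1) := by
    rw [uIcc_of_le h1]; exact (path_mono1 P).mono hsub
  have hm2 : MonotoneOn (fun s => (P.p s).2) (uIcc σ 1) := by
    rw [uIcc_of_le h1]; exact (path_mono2 P).mono hsub
  have i1 := hm1.intervalIntegrable_deriv
  have i2 := hm2.intervalIntegrable_deriv
  have j1 := hm1.intervalIntegral_deriv_mem_uIcc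
  have j2 := hm2.intervalIntegral_deriv_mem_uIcc
  have e1 : (P.p σ).1 ≤ B.1 := by
    have := path_mono1 P ⟨h0, h1⟩ (right_mem_Icc.2 zero_le_one) h1
    simpa [P.ep] using this
  have e2 : (P.p σ).2 ≤ B.2 := by
    have := path_mono2 P ⟨h0, h1⟩ (right_mem_Icc.2 zero_le_one) h1
    simpa [P.ep] using this
  rw [P.ep, uIcc_of_le (by linarith)] at j1 j2
  have hae : ∀ᵐ s ∂(volume.restrict (Ioc σ 1)), s ∈ Icc σ 1 ∧
      deriv (fun s => (P.p s).1) s = (deriv P.p s).1 ∧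
      deriv (fun s => (P.p s).2) s = (deriv P.p s).2 ∧
      0 ≤ (deriv P.p s).1 ∧ 0 ≤ (deriv P.p s).2 := by
    filter_upwards [ae_mono (Measure.restrict_mono (Ioc_subset_Ioc h0 le_rfl) le_rfl) (path_ae P),
      ae_restrict_mem measurableSet_Ioc] with s hs hs'
    exact ⟨Ioc_subset_Icc_self hs', hs.2⟩
  have key : ∀ l : ℝ, 0 < l → l < 1 → ∀ᵐ s ∂(volume.restrict (Ioc σ 1)),
      0 ≤ gam (deriv P.p s).1 (deriv P.p s).2 / c (P.p s) ∧
      gam (deriv P.p s).1 (deriv P.p s).2 / c (P.p s) ≤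
       (deriv (fun s => (P.p s).1) s / l + deriv (fun s => (P.p s).2) s / (1 - l)) / m := by
    intro l hl hl1
    filter_upwards [hae] with s hs
    obtain ⟨hs1, hs2, hs3, hs4, hs5⟩ := hs
    have hc := hlow s hs1
    refine ⟨div_nonneg (gam_nonneg _ _) (hm.le.trans hc), ?_⟩
    rw [hs2, hs3]
    have := gam_lin hl hl1 hs4 hs5
    exact div_le_div₀ ((gam_nonneg _ _).trans this) this hm hc
  have ib : ∀ l : ℝ, IntervalIntegrable (fun s => (deriv (fun s => (P.p s).1) s / l +
      deriv (fun s => (P.p s).2) s / (1 - l)) / m) volume σ 1 :=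
    fun l => ((i1.div_const l).add (i2.div_const (1 - l))).div_const m
  have hint : IntervalIntegrable
      (fun s => gam (deriv P.p s).1 (deriv P.p s).2 / c (P.p s)) volume σ 1 := by
    rw [intervalIntegrable_iff_integrableOn_Ioc_of_le h1]
    have := ib (1/2)
    rw [intervalIntegrable_iff_integrableOn_Ioc_of_le h1] at this
    refine Integrable.mono' this ?_ ?_
    · have a1 : Measurable fun s => gam (deriv P.p s).1 (deriv P.p s).2 := by
        unfold gam
        have := measurable_deriv P.p
        fun_prop
      have a2 : AEMeasurable (fun s => c (P.p s)) (volume.restrict (Ioc σ 1)) :=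
        hcm.comp_aemeasurable
          ((P.cont.mono (Ioc_subset_Icc_self.trans hsub)).aemeasurable measurableSet_Ioc)
      exact (a1.aemeasurable.div a2).aestronglyMeasurable
    · filter_upwards [key (1/2) (by norm_num) (by norm_num)] with s hs
      rw [Real.norm_of_nonneg hs.1]; exact hs.2
  refine ⟨hint, fun l hl hl1 => ?_⟩
  calc _ ≤ ∫ s in σ..1, (deriv (fun s => (P.p s).1) s / l +
      deriv (fun s => (P.p s).2) s / (1 - l)) / m := by
        rw [intervalIntegral.integral_of_le h1, intervalIntegral.integral_of_le h1]
        refine integral_mono_ae ?_ ?_ ?_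
        · exact (intervalIntegrable_iff_integrableOn_Ioc_of_le h1).1 hint
        · exact (intervalIntegrable_iff_integrableOn_Ioc_of_le h1).1 (ib l)
        · filter_upwards [key l hl hl1] with s hs using hs.2
    _ = ((∫ s in σ..1, deriv (fun s => (P.p s).1) s) / l +
        (∫ s in σ..1, deriv (fun s => (P.p s).2) s) / (1 - l)) / m := by
        rw [intervalIntegral.integral_div, intervalIntegral.integral_add
          (i1.div_const l) (i2.div_const (1 - l)), intervalIntegral.integral_div,
          intervalIntegral.integral_div]
    _ ≤ _ := by
        have : 0 < 1 - l := by linarith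
        have := j1.2
        have := j2.2
        gcongr

def LocBd (c : ℝ × ℝ → ℝ) : Prop := ∀ K : Set (ℝ × ℝ), IsCompact K →
    ∃ m M : ℝ, 0 < m ∧ ∀ z ∈ K, m ≤ c z ∧ c z ≤ M

lemma path_mem {A B : ℝ × ℝ} (P : AdmissiblePath A B) {s : ℝ} (hs : s ∈ Icc (0:ℝ) 1) :
    P.p s ∈ Icc A B := by
  have a1 := path_mono1 P (left_mem_Icc.2 zero_le_one) hs hs.1
  have a2 := path_mono2 P (left_mem_Icc.2 zero_le_one) hs hs.1
  have b1 := path_mono1 P hs (right_mem_Icc.2 zero_le_one) hs.2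
  have b2 := path_mono2 P hs (right_mem_Icc.2 zero_le_one) hs.2
  simp only [P.init, P.ep] at a1 a2 b1 b2
  exact ⟨⟨a1, a2⟩, ⟨b1, b2⟩⟩

lemma gamma_bdd {c : ℝ × ℝ → ℝ} (hcm : Measurable c) (hbd : LocBd c) (A B : ℝ × ℝ) :
    BddAbove { w : ℝ | ∃ P : AdmissiblePath A B, w = pathWeight c P.p } := by
  obtain ⟨m, M, hm, hK⟩ := hbd (Icc A B) isCompact_Icc
  refine ⟨((B.1 - A.1) / (1/2) + (B.2 - A.2) / (1 - 1/2)) / m, ?_⟩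
  rintro w ⟨P, rfl⟩
  have := (path_intble hcm P le_rfl zero_le_one hm
    (fun s hs => (hK _ (path_mem P hs)).1)).2 (1/2) (by norm_num) (by norm_num)
  rwa [P.init] at this

lemma weight_le_gamma {c : ℝ × ℝ → ℝ} (hcm : Measurable c) (hbd : LocBd c) {A B : ℝ × ℝ}
    (P : AdmissiblePath A B) : pathWeight c P.p ≤ Gamma c A B :=
  le_csSup (gamma_bdd hcm hbd A B) ⟨P, rfl⟩

noncomputable def linePath (A d : ℝ × ℝ) (hd : 0 ≤ d) : AdmissiblePath A (A + d) where
  p := fun s => A + s • d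
  cont := by fun_prop
  init := by simp
  ep := by simp
  pw := by
    refine ⟨∅, fun s _ _ => ?_⟩
    have : HasDerivAt (fun s : ℝ => A + s • d) d s := by
      simpa using ((hasDerivAt_id s).smul_const d).const_add A
    exact ⟨this.differentiableAt, by rw [this.deriv]; exact hd.1, by rw [this.deriv]; exact hd.2⟩

noncomputable def extPath {A z : ℝ × ℝ} (P : AdmissiblePath A z) (d : ℝ × ℝ) (hd : 0 ≤ d) :
    AdmissiblePath A (z + d) where
  p := fun s => if s ≤ 1/2 then P.p (2 * s) else z + (2 * s - 1) • d
  cont := by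
    apply ContinuousOn.if
    · rintro a ⟨_, ha⟩
      have : a = 1/2 := by
        have := frontier_Iic_subset (1/2 : ℝ) ha
        simpa using this
      subst this
      norm_num [P.ep]
    · have : closure {a : ℝ | a ≤ 1/2} = Iic (1/2) := closure_Iic _
      rw [this]
      refine P.cont.comp (by fun_prop) ?_
      rintro s ⟨hs, hs'⟩
      have : s ≤ 1/2 := hs'
      exact ⟨by linarith [hs.1], by linarith⟩
    · fun_prop
  init := by norm_num [P.init]
  ep := by norm_num
  pw := by
    obtain ⟨T, hT⟩ := P.pw
    refine ⟨insert (1/2) (T.image (fun t => t / 2)), fun s hs hsT => ?_⟩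
    simp only [Finset.mem_insert, Finset.mem_image, not_or, not_exists, not_and] at hsT
    rcases lt_or_gt_of_ne hsT.1 with h | h
    · have heq : (fun s => if s ≤ 1/2 then P.p (2 * s) else z + (2 * s - 1) • d) =ᶠ[𝓝 s]
          fun s => P.p (2 * s) := by
        filter_upwards [Iio_mem_nhds h] with r hr
        rw [if_pos (le_of_lt hr)]
      have h2 : (2 * s) ∉ T := fun h => hsT.2 _ h (by ring)
      have := hT (2 * s) ⟨by linarith [hs.1], by linarith⟩ h2
      have hd' : DifferentiableAt ℝ (fun s => P.p (2 * s)) s :=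
        this.1.comp s (by fun_prop)
      rw [heq.deriv_eq, heq.differentiableAt_iff, deriv_comp_mul_left]
      refine ⟨hd', ?_, ?_⟩
      · simpa using this.2.1
      · simpa using this.2.2
    · have heq : (fun s => if s ≤ 1/2 then P.p (2 * s) else z + (2 * s - 1) • d) =ᶠ[𝓝 s]
          fun s => z + (2 * s - 1) • d := by
        filter_upwards [Ioi_mem_nhds h] with r hr
        rw [if_neg (not_le.2 hr)]
      have : HasDerivAt (fun s : ℝ => z + (2 * s - 1) • d) ((2:ℝ) • d) s := by
        have h1 : HasDerivAt (fun s : ℝ => 2 * s - 1) 2 s := by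
          simpa using ((hasDerivAt_id s).const_mul 2).sub_const 1
        exact (h1.smul_const d).const_add z
      rw [heq.deriv_eq, heq.differentiableAt_iff, this.deriv]
      refine ⟨this.differentiableAt, ?_, ?_⟩
      · have := hd.1
        simpa using this
      · have := hd.2
        simpa using this

lemma extPath_weight {c : ℝ × ℝ → ℝ} (hcm : Measurable c) (hbd : LocBd c) (hpos : ∀ z, 0 < c z)
    {A z : ℝ × ℝ} (P : AdmissiblePath A z)
    (d : ℝ × ℝ) (hd : 0 ≤ d) {M : ℝ} (hM : ∀ w ∈ Icc z (z + d), c w ≤ M) :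
    pathWeight c P.p + gam d.1 d.2 / M ≤ pathWeight c (extPath P d hd).p := by
  set Q := extPath P d hd with hQ
  obtain ⟨m, M', hm, hK⟩ := hbd (Icc A (z + d)) isCompact_Icc
  have hint := (path_intble hcm Q le_rfl zero_le_one hm
    (fun s hs => (hK _ (path_mem Q hs)).1)).1
  unfold pathWeight
  have i1 : IntervalIntegrable (fun s => gam (deriv Q.p s).1 (deriv Q.p s).2 / c (Q.p s))
      volume 0 (1/2) := hint.mono_set (by
        rw [uIcc_of_le (by norm_num), uIcc_of_le (by norm_num)]
        exact Icc_subset_Icc le_rfl (by norm_num))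
  have i2 : IntervalIntegrable (fun s => gam (deriv Q.p s).1 (deriv Q.p s).2 / c (Q.p s))
      volume (1/2) 1 := hint.mono_set (by
        rw [uIcc_of_le (by norm_num), uIcc_of_le (by norm_num)]
        exact Icc_subset_Icc (by norm_num) le_rfl)
  rw [← intervalIntegral.integral_add_adjacent_intervals i1 i2]
  refine add_le_add (le_of_eq ?_) ?_
  · have : ∫ s in (0:ℝ)..(1/2), gam (deriv Q.p s).1 (deriv Q.p s).2 / c (Q.p s) =
        ∫ s in (0:ℝ)..(1/2), 2 * ((fun s => gam (deriv P.p s).1 (deriv P.p s).2 / c (P.p s))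
          (2 * s)) := by
      rw [intervalIntegral.integral_of_le (by norm_num),
        intervalIntegral.integral_of_le (by norm_num),
        integral_Ioc_eq_integral_Ioo, integral_Ioc_eq_integral_Ioo]
      refine setIntegral_congr_fun measurableSet_Ioo fun s hs => ?_
      have heq : Q.p =ᶠ[𝓝 s] fun s => P.p (2 * s) := by
        filter_upwards [Iio_mem_nhds hs.2] with r hr
        exact if_pos (le_of_lt hr)
      simp only
      rw [heq.deriv_eq, deriv_comp_mul_left, heq.eq_of_nhds]
      simp only [Prod.smul_fst, Prod.smul_snd, smul_eq_mul]
      rw [gam_smul (by norm_num), mul_div_assoc]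
    rw [this, intervalIntegral.integral_const_mul, intervalIntegral.integral_comp_mul_left
      (fun s => gam (deriv P.p s).1 (deriv P.p s).2 / c (P.p s)) (two_ne_zero' ℝ)]
    norm_num
    ring
  · have h0 : gam d.1 d.2 / M = ∫ s in (1/2 : ℝ)..1, 2 * gam d.1 d.2 / M := by
      rw [intervalIntegral.integral_const, smul_eq_mul]; ring
    rw [h0]
    refine intervalIntegral.integral_mono_on_of_le_Ioo (by norm_num) (by simp) i2 ?_
    intro s hs
    have heq : Q.p =ᶠ[𝓝 s] fun s => z + (2 * s - 1) • d := by
      filter_upwards [Ioi_mem_nhds hs.1] with r hr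
      exact if_neg (not_le.2 hr)
    have h1 : HasDerivAt (fun s : ℝ => z + (2 * s - 1) • d) ((2:ℝ) • d) s := by
      have h1 : HasDerivAt (fun s : ℝ => 2 * s - 1) 2 s := by
        simpa using ((hasDerivAt_id s).const_mul 2).sub_const 1
      exact (h1.smul_const d).const_add z
    rw [heq.deriv_eq, heq.eq_of_nhds, h1.deriv]
    simp only [Prod.smul_fst, Prod.smul_snd, smul_eq_mul]
    rw [gam_smul (by norm_num)]
    refine div_le_div_of_nonneg_left (mul_nonneg (by norm_num) (gam_nonneg _ _)) (hpos _)
      (hM _ ⟨?_, ?_⟩)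
    · exact le_add_of_nonneg_right (smul_nonneg (by linarith [hs.1]) hd)
    · have : (2 * s - 1) • d ≤ (1:ℝ) • d :=
        smul_le_smul_of_nonneg_right (by linarith [hs.2]) hd
      rw [one_smul] at this
      gcongr

/-- concatenation bound for the last passage value -/
lemma gamma_ext {c : ℝ × ℝ → ℝ} (hcm : Measurable c) (hbd : LocBd c) (hpos : ∀ z, 0 < c z)
    {A z d : ℝ × ℝ} (hAz : A ≤ z) (hd : 0 ≤ d) {M : ℝ} (hM : ∀ w ∈ Icc z (z + d), c w ≤ M) :
    Gamma c A z + gam d.1 d.2 / M ≤ Gamma c A (z + d) := by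
  rw [← le_sub_iff_add_le]
  refine csSup_le ?_ ?_
  · have h := linePath A (z - A) (sub_nonneg.2 hAz)
    rw [add_sub_cancel] at h
    exact ⟨_, h, rfl⟩
  · rintro w ⟨P, rfl⟩
    rw [le_sub_iff_add_le]
    exact (extPath_weight hcm hbd hpos P d hd hM).trans (weight_le_gamma hcm hbd _)

lemma gamma_self_nonneg {c : ℝ × ℝ → ℝ}
    (hpos : ∀ z, 0 < c z) (A : ℝ × ℝ) : 0 ≤ Gamma c A A := by
  refine Real.sSup_nonneg ?_
  rintro w ⟨P, rfl⟩
  exact intervalIntegral.integral_nonneg zero_le_one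
    fun s _ => div_nonneg (gam_nonneg _ _) (hpos _).le

noncomputable def restrPath {A B : ℝ × ℝ} (P : AdmissiblePath A B) (σ : ℝ) (h0 : 0 < σ)
    (h1 : σ ≤ 1) : AdmissiblePath A (P.p σ) where
  p := fun s => P.p (σ * s)
  cont := by
    refine P.cont.comp (by fun_prop) ?_
    intro s hs
    exact ⟨mul_nonneg h0.le hs.1, mul_le_one₀ h1 hs.1 hs.2⟩
  init := by simp [P.init]
  ep := by simp
  pw := by
    obtain ⟨T, hT⟩ := P.pw
    refine ⟨T.image (fun t => t / σ), fun s hs hsT => ?_⟩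
    simp only [Finset.mem_image, not_exists, not_and] at hsT
    have h2 : (σ * s) ∉ T := fun h => hsT _ h (by field_simp)
    have := hT (σ * s) ⟨mul_pos h0 hs.1, by nlinarith [hs.1, hs.2]⟩ h2
    have hd' : DifferentiableAt ℝ (fun s => P.p (σ * s)) s :=
      this.1.comp s (by fun_prop)
    rw [deriv_comp_mul_left]
    refine ⟨hd', ?_, ?_⟩
    · exact mul_nonneg h0.le this.2.1
    · exact mul_nonneg h0.le this.2.2

lemma restrPath_weight {c : ℝ × ℝ → ℝ} {A B : ℝ × ℝ} (P : AdmissiblePath A B) (σ : ℝ) (h0 : 0 < σ)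
    (h1 : σ ≤ 1) : pathWeight c (restrPath P σ h0 h1).p =
      ∫ s in (0:ℝ)..σ, gam (deriv P.p s).1 (deriv P.p s).2 / c (P.p s) := by
  have : pathWeight c (restrPath P σ h0 h1).p =
      ∫ s in (0:ℝ)..1, σ * ((fun s => gam (deriv P.p s).1 (deriv P.p s).2 / c (P.p s))
          (σ * s)) := by
    unfold pathWeight restrPath
    refine intervalIntegral.integral_congr fun s _ => ?_
    simp only
    rw [deriv_comp_mul_left]
    simp only [Prod.smul_fst, Prod.smul_snd, smul_eq_mul]
    rw [gam_smul h0.le, mul_div_assoc]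
  rw [this, intervalIntegral.integral_const_mul, intervalIntegral.integral_comp_mul_left
      (fun s => gam (deriv P.p s).1 (deriv P.p s).2 / c (P.p s)) h0.ne']
  simp [h0.ne']

/-- backward step -/
lemma gamma_back {c : ℝ × ℝ → ℝ} (hcm : Measurable c) (hbd : LocBd c)
    {A z : ℝ × ℝ} (P : AdmissiblePath A z) {r m l : ℝ} (hr : 0 < r) (hm : 0 < m)
    (hl : 0 < l) (hl1 : l < 1)
    (hlow : ∀ w, w ≤ z → z.1 - w.1 + (z.2 - w.2) ≤ r → m ≤ c w)
    (hbig : 2 * r / m < pathWeight c P.p) :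
    ∃ w, A ≤ w ∧ w ≤ z ∧ z.1 - w.1 + (z.2 - w.2) = r ∧
      pathWeight c P.p - ((z.1 - w.1) / l + (z.2 - w.2) / (1 - l)) / m ≤ Gamma c A w := by
  have hcont : ContinuousOn (fun s => z.1 - (P.p s).1 + (z.2 - (P.p s).2)) (Icc 0 1) := by
    have := P.cont
    fun_prop
  have hstart : r < z.1 - A.1 + (z.2 - A.2) := by
    by_contra hcon
    push Not at hcon
    have := (path_intble hcm P le_rfl zero_le_one hm (fun s hs => by
      have hmem := path_mem P hs
      refine hlow _ hmem.2 ?_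
      have h1 := hmem.1.1
      have h2 := hmem.1.2
      linarith)).2 (1/2) (by norm_num) (by norm_num)
    rw [P.init] at this
    have h3 : ((z.1 - A.1) / (1/2) + (z.2 - A.2) / (1 - 1/2)) / m ≤ 2 * r / m := by
      gcongr; norm_num; linarith
    unfold pathWeight at hbig
    linarith
  obtain ⟨σ, hσ, hσr⟩ : r ∈ (fun s => z.1 - (P.p s).1 + (z.2 - (P.p s).2)) '' Icc 0 1 := by
    apply intermediate_value_Icc' zero_le_one hcont
    simp only [P.init, P.ep, sub_self, add_zero]
    exact ⟨hr.le, hstart.le⟩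
  simp only at hσr
  have hσ0 : 0 < σ := by
    rcases hσ.1.eq_or_lt with h | h
    · subst h; rw [P.init] at hσr; linarith
    · exact h
  have hmem := path_mem P hσ
  refine ⟨P.p σ, hmem.1, hmem.2, hσr, ?_⟩
  obtain ⟨m', M', hm', hK⟩ := hbd (Icc A z) isCompact_Icc
  have hint := (path_intble hcm P le_rfl zero_le_one hm'
    (fun s hs => (hK _ (path_mem P hs)).1)).1
  have h2 := (path_intble hcm P hσ.1 hσ.2 hm (fun s hs => by
      have hs01 : s ∈ Icc (0:ℝ) 1 := ⟨hσ.1.trans hs.1, hs.2⟩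
      have hmem := path_mem P hs01
      refine hlow _ hmem.2 ?_
      have h1 : (P.p σ).1 ≤ (P.p s).1 := path_mono1 P hσ hs01 hs.1
      have h2 : (P.p σ).2 ≤ (P.p s).2 := path_mono2 P hσ hs01 hs.1
      linarith)).2 l hl hl1
  have h3 := weight_le_gamma hcm hbd (restrPath P σ hσ0 hσ.2)
  rw [restrPath_weight] at h3
  have i1 : IntervalIntegrable (fun s => gam (deriv P.p s).1 (deriv P.p s).2 / c (P.p s))
      volume 0 σ := hint.mono_set (by
        rw [uIcc_of_le hσ.1, uIcc_of_le (by norm_num)]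
        exact Icc_subset_Icc le_rfl hσ.2)
  have i2 : IntervalIntegrable (fun s => gam (deriv P.p s).1 (deriv P.p s).2 / c (P.p s))
      volume σ 1 := hint.mono_set (by
        rw [uIcc_of_le hσ.2, uIcc_of_le (by norm_num)]
        exact Icc_subset_Icc hσ.1 le_rfl)
  have h4 := intervalIntegral.integral_add_adjacent_intervals i1 i2
  unfold pathWeight
  linarith

structure Hyp (c : ℝ × ℝ → ℝ) (v₀ : ℝ → ℝ) : Prop where
  hcm : Measurable c
  hpos : ∀ z, 0 < c z
  hbd : LocBd c
  hgr : SublogGrowth c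
  hmono : Monotone v₀
  hlip : LipschitzWith 1 v₀

lemma le_gam1 {a b : ℝ} (ha : 0 ≤ a) : a ≤ gam a b := by
  unfold gam
  nlinarith [Real.sq_sqrt ha, Real.sqrt_nonneg a, Real.sqrt_nonneg b]

lemma le_gam2 {a b : ℝ} (hb : 0 ≤ b) : b ≤ gam a b := by
  unfold gam
  nlinarith [Real.sq_sqrt hb, Real.sqrt_nonneg a, Real.sqrt_nonneg b]

lemma level_nonempty {c : ℝ × ℝ → ℝ} {v₀ : ℝ → ℝ} (H : Hyp c v₀) (q x t : ℝ) :
    { y : ℝ | beta x ≤ y ∧ t ≤ GammaQ c v₀ q (x + y) y }.Nonempty := by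
  set A : ℝ × ℝ := (q - v₀ q, -v₀ q) with hA
  set k : ℝ := 1 / (|t| + 1) with hk
  have hk0 : 0 < k := by positivity
  have h1 := H.hgr A
  have h2 := Real.isLittleO_log_id_atTop.bound hk0
  have h3 : ∀ᶠ r : ℝ in atTop, sSup (c '' {u : ℝ × ℝ | max |u.1 - A.1| |u.2 - A.2| ≤ r}) ≤
      k * r := by
    filter_upwards [h1.eventually_lt_const (zero_lt_one), h2, eventually_gt_atTop 1]
      with r hr1 hr2 hr3
    have hl : 0 < Real.log r := Real.log_pos hr3
    rw [div_lt_one hl] at hr1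
    simp only [id, Real.norm_eq_abs] at hr2
    rw [abs_of_pos hl, abs_of_pos (by linarith)] at hr2
    linarith
  obtain ⟨r0, hr0⟩ := eventually_atTop.1 h3
  set y := max (beta x) (max r0 1) with hy
  have hy1 : beta x ≤ y := le_max_left _ _
  have hy2 : r0 ≤ y := (le_max_left _ _).trans (le_max_right _ _)
  have hy3 : 1 ≤ y := (le_max_right _ _).trans (le_max_right _ _)
  have hxy : 0 ≤ x + y := by
    have : -x ≤ beta x := le_max_right _ _
    linarith
  refine ⟨y, hy1, ?_⟩
  set r := max (x + y) y with hr
  have hrle : y ≤ r := le_max_right _ _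
  have hrle' : x + y ≤ r := le_max_left _ _
  have hrpos : 0 < r := by linarith
  have hS := hr0 r (hy2.trans hrle)
  have hd : (0 : ℝ × ℝ) ≤ (x + y, y) := ⟨hxy, by simp; linarith⟩
  have hbdd : BddAbove (c '' {u : ℝ × ℝ | max |u.1 - A.1| |u.2 - A.2| ≤ r}) := by
    obtain ⟨m, M, hm, hK⟩ := H.hbd (Icc (A.1 - r, A.2 - r) (A.1 + r, A.2 + r)) isCompact_Icc
    refine ⟨M, ?_⟩
    rintro _ ⟨w, hw, rfl⟩
    have hw' : max |w.1 - A.1| |w.2 - A.2| ≤ r := hw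
    rw [max_le_iff, abs_le, abs_le] at hw'
    exact (hK w ⟨⟨by simp only; linarith, by simp only; linarith⟩,
      ⟨by simp only; linarith, by simp only; linarith⟩⟩).2
  have hext := gamma_ext (A := A) (z := A) H.hcm H.hbd H.hpos le_rfl hd (M := k * r) (by
    rintro w ⟨⟨hw1, hw2⟩, ⟨hw3, hw4⟩⟩
    refine (le_csSup hbdd ⟨w, ?_, rfl⟩).trans hS
    simp only [Prod.fst_add, Prod.snd_add] at hw3 hw4
    show max |w.1 - A.1| |w.2 - A.2| ≤ r
    refine max_le (abs_le.2 ⟨?_, ?_⟩) (abs_le.2 ⟨?_, ?_⟩) <;> linarith)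
  have h0 := gamma_self_nonneg H.hpos A
  have hg : r ≤ gam (x + y) y := max_le (le_gam1 hxy) (le_gam2 (by linarith))
  have hg2 : |t| + 1 ≤ gam (x + y) y / (k * r) := by
    rw [le_div_iff₀ (by positivity), hk]
    calc (|t| + 1) * (1 / (|t| + 1) * r) = r := by
          have : |t| + 1 ≠ 0 := by positivity
          field_simp
      _ ≤ _ := hg
  have hAe : A + (x + y, y) = (x + y + q - v₀ q, y - v₀ q) := by
    ext <;> simp [hA] <;> ring
  rw [hAe] at hext
  unfold GammaQ
  have := le_abs_self t
  simp only at hext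
  linarith

lemma lip_real {v₀ : ℝ → ℝ} (h : LipschitzWith 1 v₀) (q x : ℝ) : v₀ q - v₀ x ≤ |q - x| := by
  have := h.dist_le_mul q x
  simp only [Real.dist_eq, NNReal.coe_one, one_mul] at this
  exact (le_abs_self _).trans this

lemma hydro_bdd {c : ℝ × ℝ → ℝ} {v₀ : ℝ → ℝ} (H : Hyp c v₀) (x t : ℝ) :
    BddAbove (range fun q : ℝ => v₀ q - levelCurve c v₀ q (x - q) t) := by
  refine ⟨v₀ x, ?_⟩
  rintro _ ⟨q, rfl⟩
  have h1 : beta (x - q) ≤ levelCurve c v₀ q (x - q) t :=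
    le_csInf (level_nonempty H q (x - q) t) fun y hy => hy.1
  have h2 : 0 ≤ beta (x - q) := le_max_left _ _
  have h3 : -(x - q) ≤ beta (x - q) := le_max_right _ _
  simp only
  rcases le_total q x with h | h
  · have := H.hmono h; linarith
  · have := lip_real H.hlip q x
    rw [abs_of_nonneg (by linarith)] at this
    linarith

def Rch (c : ℝ × ℝ → ℝ) (v₀ : ℝ → ℝ) (t : ℝ) (z : ℝ × ℝ) : Prop :=
  ∃ q : ℝ, ((q - v₀ q, -v₀ q) : ℝ × ℝ) ≤ z ∧ t ≤ Gamma c (q - v₀ q, -v₀ q) z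

lemma u_le {c : ℝ × ℝ → ℝ} {v₀ : ℝ → ℝ} (H : Hyp c v₀) {x t Y : ℝ}
    (h : Rch c v₀ t (x + Y, Y)) : -hydroV c v₀ x t ≤ Y := by
  obtain ⟨q, ⟨h1, h2⟩, h3⟩ := h
  simp only at h1 h2
  have : levelCurve c v₀ q (x - q) t ≤ Y + v₀ q := by
    refine csInf_le ⟨beta (x - q), fun y hy => hy.1⟩ ⟨max_le (by linarith) (by linarith), ?_⟩
    unfold GammaQ
    convert h3 using 3 <;> ring
  have h5 := le_ciSup (hydro_bdd H x t) q
  unfold hydroV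
  linarith

lemma u_near {c : ℝ × ℝ → ℝ} {v₀ : ℝ → ℝ} (H : Hyp c v₀) (x t : ℝ) {ε : ℝ} (hε : 0 < ε) :
    ∃ Y, -hydroV c v₀ x t ≤ Y ∧ Y < -hydroV c v₀ x t + ε ∧ Rch c v₀ t (x + Y, Y) := by
  obtain ⟨q, hq⟩ := exists_lt_of_lt_ciSup (show hydroV c v₀ x t - ε <
    ⨆ q : ℝ, (v₀ q - levelCurve c v₀ q (x - q) t) from by unfold hydroV; linarith)
  obtain ⟨y, hy, hy2⟩ := exists_lt_of_csInf_lt (level_nonempty H q (x - q) t)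
    (show sInf _ < v₀ q - hydroV c v₀ x t + ε from by unfold levelCurve at hq; linarith)
  have hR : Rch c v₀ t (x + (y - v₀ q), y - v₀ q) := by
    have h1 : 0 ≤ beta (x - q) := le_max_left _ _
    have h2 : -(x - q) ≤ beta (x - q) := le_max_right _ _
    have h3 := hy.1
    refine ⟨q, ⟨by simp only; linarith, by simp only; linarith⟩, ?_⟩
    have h4 := hy.2
    unfold GammaQ at h4
    convert h4 using 3
    ring
  exact ⟨y - v₀ q, u_le H hR, by linarith, hR⟩

lemma Rch_ext {c : ℝ × ℝ → ℝ} {v₀ : ℝ → ℝ} (H : Hyp c v₀) {t : ℝ} {z d : ℝ × ℝ}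
    (h : Rch c v₀ t z) (hd : 0 ≤ d) {M : ℝ} (hM : ∀ w ∈ Icc z (z + d), c w ≤ M) :
    Rch c v₀ (t + gam d.1 d.2 / M) (z + d) := by
  obtain ⟨q, h1, h2⟩ := h
  refine ⟨q, h1.trans (le_add_of_nonneg_right hd), ?_⟩
  have := gamma_ext H.hcm H.hbd H.hpos h1 hd hM
  linarith

lemma u_step {c : ℝ × ℝ → ℝ} {v₀ : ℝ → ℝ} (H : Hyp c v₀) {x t d1 d2 M δ : ℝ}
    (h1 : 0 ≤ d1) (h2 : 0 ≤ d2) (hδ : 0 < δ)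
    (hM : ∀ w1 w2, x + -hydroV c v₀ x t ≤ w1 → w1 ≤ x + -hydroV c v₀ x t + d1 + δ →
      -hydroV c v₀ x t ≤ w2 → w2 ≤ -hydroV c v₀ x t + d2 + δ → c (w1, w2) ≤ M) :
    -hydroV c v₀ (x + d1 - d2) (t + gam d1 d2 / M) ≤ -hydroV c v₀ x t + d2 := by
  refine le_of_forall_pos_le_add fun ε hε => ?_
  obtain ⟨Y, hY0, hY, hR⟩ := u_near H x t (lt_min hε hδ)
  have hY1 := hY.trans_le (add_le_add_right (min_le_left ε δ) _)
  have hY2 := hY.trans_le (add_le_add_right (min_le_right ε δ) _)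
  have hR' := Rch_ext H hR (d := (d1, d2)) ⟨h1, h2⟩ (M := M) (by
    rintro ⟨w1, w2⟩ ⟨⟨a1, a2⟩, ⟨a3, a4⟩⟩
    simp only [Prod.fst_add, Prod.snd_add] at a1 a2 a3 a4
    exact hM w1 w2 (by linarith) (by linarith) (by linarith) (by linarith))
  have : ((x + Y, Y) : ℝ × ℝ) + (d1, d2) = (x + d1 - d2 + (Y + d2), Y + d2) := by
    ext <;> simp; ring
  rw [this] at hR'
  have := u_le H hR'
  linarith

lemma u_mono_t {c : ℝ × ℝ → ℝ} {v₀ : ℝ → ℝ} (H : Hyp c v₀) (x : ℝ) {t t' : ℝ} (h : t ≤ t') :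
    -hydroV c v₀ x t ≤ -hydroV c v₀ x t' := by
  refine le_of_forall_pos_le_add fun ε hε => ?_
  obtain ⟨Y, hY0, hY, q, hq, hq2⟩ := u_near H x t' hε
  exact (u_le H ⟨q, hq, h.trans hq2⟩).trans hY.le

lemma u_step0 {c : ℝ × ℝ → ℝ} {v₀ : ℝ → ℝ} (H : Hyp c v₀) {x t d1 d2 : ℝ}
    (h1 : 0 ≤ d1) (h2 : 0 ≤ d2) :
    -hydroV c v₀ (x + d1 - d2) t ≤ -hydroV c v₀ x t + d2 := by
  set u := -hydroV c v₀ x t with hu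
  obtain ⟨m, M, hm, hK⟩ := H.hbd (Icc (x + u, u) (x + u + d1 + 1, u + d2 + 1)) isCompact_Icc
  have hM0 : 0 ≤ M := (H.hpos _).le.trans (hK (x + u, u)
    ⟨le_rfl, ⟨by simp only; linarith, by simp only; linarith⟩⟩).2
  have := u_step H (x := x) (t := t) h1 h2 zero_lt_one (M := M)
    fun w1 w2 a b c d => (hK (w1, w2) ⟨⟨a, c⟩, ⟨b, d⟩⟩).2
  refine le_trans (u_mono_t H _ ?_) this
  have := div_nonneg (gam_nonneg d1 d2) hM0
  linarith

lemma u_anti_x {c : ℝ × ℝ → ℝ} {v₀ : ℝ → ℝ} (H : Hyp c v₀) {x x' : ℝ} (t : ℝ) (h : x ≤ x') :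
    -hydroV c v₀ x' t ≤ -hydroV c v₀ x t := by
  have := u_step0 H (x := x) (t := t) (d1 := x' - x) (d2 := 0) (by linarith) le_rfl
  simpa using this

lemma u_lip_x {c : ℝ × ℝ → ℝ} {v₀ : ℝ → ℝ} (H : Hyp c v₀) {x x' : ℝ} (t : ℝ) (h : x ≤ x') :
    -hydroV c v₀ x t ≤ -hydroV c v₀ x' t + (x' - x) := by
  have := u_step0 H (x := x') (t := t) (d1 := 0) (d2 := x' - x) le_rfl (by linarith)
  simpa using this

lemma gam_diag {h : ℝ} (hh : 0 ≤ h) : gam h h = 4 * h := by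
  unfold gam
  have := Real.sq_sqrt hh
  nlinarith

lemma u_lip_t {c : ℝ × ℝ → ℝ} {v₀ : ℝ → ℝ} (H : Hyp c v₀) {x t t' M U N : ℝ} (h : t ≤ t')
    (hM : 0 < M) (hx : |x| ≤ N) (hu : |hydroV c v₀ x t| ≤ U) (hu' : |hydroV c v₀ x t'| ≤ U)
    (hK : ∀ w1 w2 : ℝ, |w1| ≤ U + N + 1 → |w2| ≤ U + N + 1 → c (w1, w2) ≤ M) :
    -hydroV c v₀ x t' ≤ -hydroV c v₀ x t + M / 4 * (t' - t) := by
  by_contra hcon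
  push Not at hcon
  set d := M / 4 * (t' - t) with hd
  have hd0 : 0 ≤ d := mul_nonneg (by positivity) (by linarith)
  rw [abs_le] at hx hu hu'
  have := u_step H (x := x) (t := t) hd0 hd0 zero_lt_one (M := M) (by
    intro w1 w2 a1 a2 a3 a4
    refine hK w1 w2 (abs_le.2 ⟨?_, ?_⟩) (abs_le.2 ⟨?_, ?_⟩) <;> linarith)
  rw [gam_diag hd0] at this
  have e : t + 4 * d / M = t' := by rw [hd]; field_simp; ring
  rw [e, add_sub_cancel_right] at this
  linarith

lemma u_loclip {c : ℝ × ℝ → ℝ} {v₀ : ℝ → ℝ} (H : Hyp c v₀) (N : ℝ) :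
    ∃ C, LipschitzOnWith C (fun p : ℝ × ℝ => hydroV c v₀ p.1 p.2) (Metric.ball 0 N) := by
  set U := |hydroV c v₀ 0 N| + |hydroV c v₀ 0 (-N)| + |N| with hU
  obtain ⟨m, M, hm, hK⟩ := H.hbd (Icc (-(U+N+1), -(U+N+1)) (U+N+1, U+N+1)) isCompact_Icc
  have hball : ∀ p ∈ Metric.ball (0 : ℝ × ℝ) N, |p.1| < N ∧ |p.2| < N := by
    intro p hp
    rw [mem_ball_zero_iff, Prod.norm_def, max_lt_iff] at hp
    simpa using hp
  have hub : ∀ x t, |x| ≤ N → |t| ≤ N → |hydroV c v₀ x t| ≤ U := by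
    intro x t hx ht
    rw [abs_le] at hx ht
    have h1 := u_mono_t H 0 ht.1
    have h2 := u_mono_t H 0 ht.2
    have h3 := le_abs_self (hydroV c v₀ 0 (-N))
    have h4 := neg_abs_le (hydroV c v₀ 0 N)
    have h5 := le_abs_self N
    have h6 := abs_nonneg (hydroV c v₀ 0 N)
    have h7 := abs_nonneg (hydroV c v₀ 0 (-N))
    rw [abs_le]
    rcases le_total 0 x with h | h
    · have a := u_anti_x H t h
      have b := u_lip_x H t h
      constructor <;> linarith
    · have a := u_anti_x H t h
      have b := u_lip_x H t h
      constructor <;> linarith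
  set M' := max M 1 with hM'
  have hM0 : 0 < M' := lt_of_lt_of_le one_pos (le_max_right _ _)
  have hlt : ∀ x t t', |x| ≤ N → |t| ≤ N → |t'| ≤ N → 
      |hydroV c v₀ x t - hydroV c v₀ x t'| ≤ M' / 4 * |t - t'| := by
    have key : ∀ x t t', |x| ≤ N → |t| ≤ N → |t'| ≤ N → t ≤ t' →
        |hydroV c v₀ x t - hydroV c v₀ x t'| ≤ M' / 4 * |t - t'| := by
      intro x t t' hx ht ht' h
      have a := u_lip_t H h hM0 hx (hub x t hx ht) (hub x t' hx ht') (fun w1 w2 a b =>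
        (hK (w1, w2) (by
          rw [abs_le] at a b
          exact ⟨⟨a.1, b.1⟩, ⟨a.2, b.2⟩⟩)).2.trans (le_max_left _ _))
      have b := u_mono_t H x h
      rw [abs_of_nonneg (by linarith), abs_of_nonpos (by linarith)]
      linarith
    intro x t t' hx ht ht'
    rcases le_total t t' with h | h
    · exact key x t t' hx ht ht' h
    · rw [abs_sub_comm, abs_sub_comm t]; exact key x t' t hx ht' ht h
  have hlx : ∀ x x' t, |hydroV c v₀ x t - hydroV c v₀ x' t| ≤ |x - x'| := by
    have key : ∀ x x' t, x ≤ x' → |hydroV c v₀ x t - hydroV c v₀ x' t| ≤ |x - x'| := by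
      intro x x' t h
      have a := u_anti_x H t h
      have b := u_lip_x H t h
      rw [abs_of_nonpos (by linarith), abs_of_nonpos (by linarith)]
      linarith
    intro x x' t
    rcases le_total x x' with h | h
    · exact key x x' t h
    · rw [abs_sub_comm, abs_sub_comm x]; exact key x' x t h
  refine ⟨Real.toNNReal (1 + M' / 4), LipschitzOnWith.of_dist_le_mul ?_⟩
  rintro ⟨x, t⟩ hp ⟨x', t'⟩ hp'
  obtain ⟨a1, a2⟩ := hball _ hp
  obtain ⟨a3, a4⟩ := hball _ hp'
  rw [Real.dist_eq, Prod.dist_eq, Real.dist_eq, Real.dist_eq, Real.coe_toNNReal _ (by positivity)]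
  simp only at *
  have b1 := hlt x' t t' a3.le a2.le a4.le
  have b2 := hlx x x' t
  have b3 := abs_sub_le (hydroV c v₀ x t) (hydroV c v₀ x' t) (hydroV c v₀ x' t')
  have m1 := le_max_left |x - x'| |t - t'|
  have m2 := le_max_right |x - x'| |t - t'|
  have m3 : M' / 4 * |t - t'| ≤ M' / 4 * max |x - x'| |t - t'| := by gcongr
  linarith

lemma v_cont {c : ℝ × ℝ → ℝ} {v₀ : ℝ → ℝ} (H : Hyp c v₀) :
    Continuous (fun p : ℝ × ℝ => hydroV c v₀ p.1 p.2) := by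
  rw [continuous_iff_continuousAt]
  intro p
  obtain ⟨C, hC⟩ := u_loclip H (‖p‖ + 1)
  exact hC.continuousOn.continuousAt (Metric.isOpen_ball.mem_nhds (by simp))

lemma v_ae_diff {c : ℝ × ℝ → ℝ} {v₀ : ℝ → ℝ} (H : Hyp c v₀) :
    ∀ᵐ p : ℝ × ℝ, DifferentiableAt ℝ (fun p : ℝ × ℝ => hydroV c v₀ p.1 p.2) p := by
  have : ∀ n : ℕ, ∀ᵐ p : ℝ × ℝ, p ∈ Metric.ball (0 : ℝ × ℝ) n →
      DifferentiableWithinAt ℝ (fun p : ℝ × ℝ => hydroV c v₀ p.1 p.2) (Metric.ball 0 n) p := by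
    intro n
    obtain ⟨C, hC⟩ := u_loclip H n
    exact hC.ae_differentiableWithinAt_of_mem
  filter_upwards [ae_all_iff.2 this] with p hp
  obtain ⟨n, hn⟩ := exists_nat_gt ‖p‖
  have hm : p ∈ Metric.ball (0 : ℝ × ℝ) n := by simpa using hn
  exact (hp n hm).differentiableAt (Metric.isOpen_ball.mem_nhds hm)

lemma slope_pos_right {g : ℝ → ℝ} {a : ℝ} (h : HasDerivAt g a 0) (ha : 0 < a) {s0 : ℝ}
    (hs0 : 0 < s0) : ∃ s, 0 < s ∧ s < s0 ∧ g 0 < g s := by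
  have h1 := h.tendsto_slope_zero_right
  have h2 := (h1.eventually_const_lt ha).and (Ioo_mem_nhdsGT hs0)
  obtain ⟨s, hs, hs'⟩ := h2.exists
  simp only [zero_add, smul_eq_mul] at hs
  refine ⟨s, hs'.1, hs'.2, ?_⟩
  have := pos_of_mul_pos_right hs (inv_pos.2 hs'.1).le
  linarith

lemma dir_deriv {g : ℝ × ℝ → ℝ} {L : ℝ × ℝ →L[ℝ] ℝ} {x t : ℝ} (h : HasFDerivAt g L (x, t))
    (a b : ℝ) : HasDerivAt (fun s : ℝ => g (x + s * a, t + s * b))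
      (a * L (1, 0) + b * L (0, 1)) 0 := by
  have h1 : HasDerivAt (fun s : ℝ => ((x + s * a, t + s * b) : ℝ × ℝ)) (a, b) 0 := by
    have e1 : HasDerivAt (fun s : ℝ => x + s * a) a 0 := by
      simpa using ((hasDerivAt_id (0:ℝ)).mul_const a).const_add x
    have e2 : HasDerivAt (fun s : ℝ => t + s * b) b 0 := by
      simpa using ((hasDerivAt_id (0:ℝ)).mul_const b).const_add t
    exact e1.prodMk e2
  have h2 : HasFDerivAt g L ((fun s : ℝ => ((x + s * a, t + s * b) : ℝ × ℝ)) 0) := by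
    simpa using h
  have h3 := h2.comp_hasDerivAt (0:ℝ) h1
  have e : L (a, b) = a * L (1, 0) + b * L (0, 1) := by
    have : ((a, b) : ℝ × ℝ) = a • (1, 0) + b • (0, 1) := by ext <;> simp
    rw [this, map_add, map_smul, map_smul]; simp
  rw [← e]
  exact h3

lemma lin2_apply (L : ℝ × ℝ →L[ℝ] ℝ) (a b : ℝ) : L (a, b) = a * L (1, 0) + b * L (0, 1) := by
  have : ((a, b) : ℝ × ℝ) = a • (1, 0) + b • (0, 1) := by ext <;> simp
  rw [this, map_add, map_smul, map_smul]; simp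

lemma sign_facts {c : ℝ × ℝ → ℝ} {v₀ : ℝ → ℝ} (H : Hyp c v₀) {x t : ℝ} {L : ℝ × ℝ →L[ℝ] ℝ}
    (hF : HasFDerivAt (fun p : ℝ × ℝ => hydroV c v₀ p.1 p.2) L (x, t)) :
    0 ≤ L (1, 0) ∧ L (1, 0) ≤ 1 ∧ L (0, 1) ≤ 0 := by
  refine ⟨?_, ?_, ?_⟩
  · by_contra hcon
    push Not at hcon
    have h := (dir_deriv hF 1 0).neg
    obtain ⟨s, hs, _, hs2⟩ := slope_pos_right h (by linarith) one_pos
    have := u_anti_x H t (show x ≤ x + s by linarith)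
    simp at hs2
    linarith
  · by_contra hcon
    push Not at hcon
    have h := (dir_deriv hF 1 0).sub (hasDerivAt_id (0:ℝ))
    obtain ⟨s, hs, _, hs2⟩ := slope_pos_right h (by linarith) one_pos
    have := u_lip_x H t (show x ≤ x + s by linarith)
    simp at hs2
    linarith
  · by_contra hcon
    push Not at hcon
    have h := (dir_deriv hF 0 1)
    obtain ⟨s, hs, _, hs2⟩ := slope_pos_right h (by linarith) one_pos
    have := u_mono_t H x (show t ≤ t + s by linarith)
    simp at hs2
    linarith

lemma upper_near {c : ℝ × ℝ → ℝ} {v₀ : ℝ → ℝ} (H : Hyp c v₀) {x t : ℝ} {L : ℝ × ℝ →L[ℝ] ℝ}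
    (hF : HasFDerivAt (fun p : ℝ × ℝ => hydroV c v₀ p.1 p.2) L (x, t))
    (hC : ContinuousAt (fun p : ℝ × ℝ =>
        c (p.1 + -(hydroV c v₀ p.1 p.2), -(hydroV c v₀ p.1 p.2))) (x, t))
    (hτ : L (0, 1) < 0) {M : ℝ} (hM : c (x + -(hydroV c v₀ x t), -(hydroV c v₀ x t)) < M) :
    ∀ᶠ w in 𝓝 ((x + -(hydroV c v₀ x t), -(hydroV c v₀ x t)) : ℝ × ℝ), c w ≤ M := by
  have h1 := hC.eventually_lt_const hM
  obtain ⟨δ, hδ, hball⟩ := Metric.eventually_nhds_iff.1 h1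
  obtain ⟨s1, hs1, hs1', hs1v⟩ := slope_pos_right (dir_deriv hF 0 1).neg (by linarith) hδ
  obtain ⟨s2, hs2, hs2', hs2v⟩ := slope_pos_right (dir_deriv hF 0 (-1)) (by linarith) hδ
  simp at hs1v hs2v
  have hcv := v_cont H
  have c1 : Continuous fun w : ℝ × ℝ => hydroV c v₀ (w.1 - w.2) (t + s1) :=
    hcv.comp (f := fun w : ℝ × ℝ => (w.1 - w.2, t + s1)) (by fun_prop)
  have c2 : Continuous fun w : ℝ × ℝ => hydroV c v₀ (w.1 - w.2) (t + -s2) :=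
    hcv.comp (f := fun w : ℝ × ℝ => (w.1 - w.2, t + -s2)) (by fun_prop)
  have o1 : IsOpen {w : ℝ × ℝ | |w.1 - w.2 - x| < δ} :=
    isOpen_lt (by fun_prop) continuous_const
  have o2 : IsOpen {w : ℝ × ℝ | w.2 < -hydroV c v₀ (w.1 - w.2) (t + s1)} :=
    isOpen_lt continuous_snd c1.neg
  have o3 : IsOpen {w : ℝ × ℝ | -hydroV c v₀ (w.1 - w.2) (t + -s2) < w.2} :=
    isOpen_lt c2.neg continuous_snd
  filter_upwards [o1.mem_nhds (by simpa using hδ), o2.mem_nhds (by simpa using hs1v),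
    o3.mem_nhds (by simpa using hs2v)] with w hw1 hw2 hw3
  change |w.1 - w.2 - x| < δ at hw1
  change w.2 < -hydroV c v₀ (w.1 - w.2) (t + s1) at hw2
  change -hydroV c v₀ (w.1 - w.2) (t + -s2) < w.2 at hw3
  have c3 : Continuous fun s : ℝ => -hydroV c v₀ (w.1 - w.2) s :=
    (hcv.comp (f := fun s : ℝ => (w.1 - w.2, s)) (by fun_prop)).neg
  obtain ⟨t', ht', htw⟩ := intermediate_value_Icc (show t + -s2 ≤ t + s1 by linarith)
    c3.continuousOn ⟨hw3.le, hw2.le⟩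
  simp only at htw
  have := hball (y := (w.1 - w.2, t')) (by
    rw [Prod.dist_eq, max_lt_iff, Real.dist_eq, Real.dist_eq]
    refine ⟨hw1, abs_lt.2 ⟨?_, ?_⟩⟩
    · have := ht'.1; simp only; linarith
    · have := ht'.2; simp only; linarith)
  simp only [htw, sub_add_cancel] at this
  exact this.le

lemma dir1 {c : ℝ × ℝ → ℝ} {v₀ : ℝ → ℝ} (H : Hyp c v₀) {x t : ℝ} {L : ℝ × ℝ →L[ℝ] ℝ}
    (hF : HasFDerivAt (fun p : ℝ × ℝ => hydroV c v₀ p.1 p.2) L (x, t))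
    (hC : ContinuousAt (fun p : ℝ × ℝ =>
        c (p.1 + -(hydroV c v₀ p.1 p.2), -(hydroV c v₀ p.1 p.2))) (x, t)) :
    -L (0, 1) ≤ c (x + -(hydroV c v₀ x t), -(hydroV c v₀ x t)) * L (1, 0) * (1 - L (1, 0)) := by
  obtain ⟨hp0, hp1, hτ0⟩ := sign_facts H hF
  by_contra hcon
  push Not at hcon
  set c0 := c (x + -(hydroV c v₀ x t), -(hydroV c v₀ x t)) with hc0
  have hc0p : 0 < c0 := H.hpos _
  set p := L (1, 0) with hp
  set τ := L (0, 1) with hτ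
  have ha : 0 ≤ p * (1 - p) := mul_nonneg hp0 (by linarith)
  have ha1 : p * (1 - p) ≤ 1 := by nlinarith
  have hc0a : 0 ≤ c0 * p * (1 - p) := by rw [mul_assoc]; exact mul_nonneg hc0p.le ha
  set ε := (-τ - c0 * p * (1 - p)) / 2 with hε
  have hε0 : 0 < ε := by rw [hε]; linarith
  set M := c0 + ε with hM
  have hM0 : 0 < M := by linarith
  have hMa : M * (p * (1 - p)) < -τ := by
    rw [hM]; nlinarith
  have hnear := upper_near H hF hC (by linarith) (show c0 < M by linarith)
  obtain ⟨ρ, hρ, hball⟩ := Metric.eventually_nhds_iff.1 hnear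
  have hder := ((dir_deriv hF (1 - 2 * p) (1 / M)).neg).sub
    ((hasDerivAt_id (0:ℝ)).mul_const (p ^ 2))
  have hpos : 0 < -((1 - 2 * p) * p + 1 / M * τ) - 1 * p ^ 2 := by
    have : p * (1 - p) < -τ / M := by rw [lt_div_iff₀ hM0]; linarith
    have e : 1 / M * τ = -(-τ / M) := by ring
    rw [e]; nlinarith
  obtain ⟨s, hs0, hs1, hs2⟩ := slope_pos_right hder hpos (show 0 < ρ / 3 by linarith)
  have hq1 : (1 - p) ^ 2 ≤ 1 := by nlinarith
  have hq2 : p ^ 2 ≤ 1 := by nlinarith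
  have d1 : s * (1 - p) ^ 2 ≤ s := mul_le_of_le_one_right hs0.le hq1
  have d2 : s * p ^ 2 ≤ s := mul_le_of_le_one_right hs0.le hq2
  have hstep := u_step H (x := x) (t := t) (d1 := s * (1 - p) ^ 2) (d2 := s * p ^ 2)
    (M := M) (δ := ρ / 3) (by positivity) (by positivity) (by linarith) (by
      intro w1 w2 a1 a2 a3 a4
      refine hball ?_
      rw [Prod.dist_eq, max_lt_iff, Real.dist_eq, Real.dist_eq, abs_lt, abs_lt]
      refine ⟨⟨?_, ?_⟩, ⟨?_, ?_⟩⟩ <;> simp only <;> linarith)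
  have hg : gam (s * (1 - p) ^ 2) (s * p ^ 2) = s := by
    rw [gam_smul hs0.le]
    unfold gam
    rw [Real.sqrt_sq (by linarith), Real.sqrt_sq hp0]; ring
  rw [hg] at hstep
  have e1 : x + s * (1 - p) ^ 2 - s * p ^ 2 = x + s * (1 - 2 * p) := by ring
  have e2 : t + s / M = t + s * (1 / M) := by ring
  rw [e1, e2] at hstep
  simp at hs2
  rw [one_div] at hstep
  linarith

set_option maxHeartbeats 2000000 in
lemma dir2 {c : ℝ × ℝ → ℝ} {v₀ : ℝ → ℝ} (H : Hyp c v₀) (hlsc : LowerSemicontinuous c)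
    {x t : ℝ} (ht : 0 < t) {L : ℝ × ℝ →L[ℝ] ℝ}
    (hF : HasFDerivAt (fun p : ℝ × ℝ => hydroV c v₀ p.1 p.2) L (x, t)) :
    c (x + -(hydroV c v₀ x t), -(hydroV c v₀ x t)) * L (1, 0) * (1 - L (1, 0)) ≤ -L (0, 1) := by
  obtain ⟨hp0, hp1, hτ0⟩ := sign_facts H hF
  by_contra hcon
  push Not at hcon
  have hLa := lin2_apply L
  set v := hydroV c v₀ x t with hv
  set c0 := c (x + -v, -v) with hc0
  have hc0p : 0 < c0 := H.hpos _
  set p := L (1, 0) with hp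
  obtain ⟨τ, hτ⟩ : ∃ τ, τ = -L (0, 1) := ⟨_, rfl⟩
  rw [← hτ] at hcon
  have hτ0' : 0 ≤ τ := by linarith
  set a := p * (1 - p) with ha
  have ha0 : 0 < a := by
    by_contra hn
    push Not at hn
    rw [mul_assoc] at hcon
    nlinarith
  have hp0' : 0 < p := by
    rcases hp0.eq_or_lt with h | h
    · rw [ha, ← h] at ha0; simp at ha0
    · exact h
  have hp1' : 0 < 1 - p := by
    rcases hp1.eq_or_lt with h | h
    · rw [ha, h] at ha0; simp at ha0
    · linarith
  have hap : a ≤ p := by rw [ha]; nlinarith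
  have hap' : a ≤ 1 - p := by rw [ha]; nlinarith
  obtain ⟨m, hm1, hm2⟩ := exists_between (show τ / a < c0 by
    rw [div_lt_iff₀ ha0, ha]; linarith)
  have hm0 : 0 < m := (div_nonneg hτ0' ha0.le).trans_lt hm1
  rw [div_lt_iff₀ ha0] at hm1
  have hma : 0 < m * a := mul_pos hm0 ha0
  obtain ⟨ρ, hρ, hball⟩ := Metric.eventually_nhds_iff.1 (hlsc (x + -v, -v) m hm2)
  set k := τ / (m * a) with hk
  have hk1 : 0 < 1 - k := by
    have : k < 1 := by rw [hk, div_lt_one hma]; exact hm1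
    linarith
  set B := 1 + 1 / (m * a) with hB
  have hB0 : 0 < B := by positivity
  have hB1 : 1 ≤ B := by rw [hB]; have : 0 < 1 / (m * a) := by positivity
                         linarith
  set η := (1 - k) * a / (4 * B) with hη
  have hη0 : 0 < η := by positivity
  obtain ⟨ρ1, hρ1, hdiff⟩ := Metric.eventually_nhds_iff.1 (hF.isLittleO.def hη0)
  obtain ⟨r, hr0, hrlt⟩ := exists_between (show 0 < min (ρ / 2) (min (m * t / 4) (ρ1 / B)) by
    positivity)
  rw [lt_min_iff, lt_min_iff] at hrlt
  obtain ⟨hr1, hr2, hr3⟩ := hrlt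
  rw [lt_div_iff₀ hB0] at hr3
  set e := min r (min (t / 4) ((1 - k) * a * r / (4 * (1 + τ)))) with he
  have he0 : 0 < e := by positivity
  have he1 : e ≤ r := min_le_left _ _
  have he2 : e ≤ t / 4 := (min_le_right _ _).trans (min_le_left _ _)
  have he3 : e ≤ (1 - k) * a * r / (4 * (1 + τ)) := (min_le_right _ _).trans (min_le_right _ _)
  rw [le_div_iff₀ (by positivity)] at he3
  obtain ⟨Y, hY0, hY1, q, hq1, hq2⟩ := u_near H x t he0
  rw [← hv] at hY0 hY1
  have hne : {w : ℝ | ∃ P : AdmissiblePath (q - v₀ q, -v₀ q) (x + Y, Y),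
      w = pathWeight c P.p}.Nonempty := by
    have h := linePath ((q - v₀ q, -v₀ q) : ℝ × ℝ) _ (sub_nonneg.2 hq1)
    rw [add_sub_cancel] at h
    exact ⟨_, h, rfl⟩
  obtain ⟨_, ⟨P, rfl⟩, hPw⟩ := exists_lt_of_lt_csSup hne
    (show t - e < sSup _ from by unfold Gamma at hq2; linarith)
  obtain ⟨w, hw1, hw2, hw3, hw4⟩ := gamma_back H.hcm H.hbd P (r := r) (m := m) (l := 1 - p)
    hr0 hm0 hp1' (by linarith) (by
      rintro ⟨w1, w2⟩ ⟨b1, b2⟩ b3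
      simp only at b1 b2 b3
      refine (hball ?_).le
      rw [Prod.dist_eq, max_lt_iff, Real.dist_eq, Real.dist_eq, abs_lt, abs_lt]
      refine ⟨⟨?_, ?_⟩, ⟨?_, ?_⟩⟩ <;> simp only <;> linarith) (by
      have : 2 * r / m < t / 2 := by rw [div_lt_iff₀ hm0]; linarith
      linarith)
  obtain ⟨w1, w2⟩ := w
  simp only at hw3 hw4
  have hw21 : w1 ≤ x + Y := hw2.1
  have hw22 : w2 ≤ Y := hw2.2
  obtain ⟨d1, hd1⟩ : ∃ d1, d1 = x + Y - w1 := ⟨_, rfl⟩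
  obtain ⟨d2, hd2⟩ : ∃ d2, d2 = Y - w2 := ⟨_, rfl⟩
  rw [← hd1, ← hd2] at hw3 hw4
  set ℓ := p * d1 + (1 - p) * d2 with hℓ
  have hd10 : 0 ≤ d1 := by linarith
  have hd20 : 0 ≤ d2 := by linarith
  have hℓ1 : a * r ≤ ℓ := by rw [hℓ, ← hw3]; nlinarith
  have hℓ2 : ℓ ≤ r := by rw [hℓ, ← hw3]; nlinarith
  have hsum : (d1 / (1 - p) + d2 / (1 - (1 - p))) / m = ℓ / (m * a) := by
    rw [sub_sub_cancel, hℓ, ha]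
    field_simp
  rw [hsum] at hw4
  set θ := e + ℓ / (m * a) with hθ
  have hℓ0 : 0 ≤ ℓ := le_trans (by positivity) hℓ1
  have hθ0 : 0 ≤ θ := by positivity
  have hθ1 : θ ≤ r * B := by
    have : ℓ / (m * a) ≤ r / (m * a) := by gcongr
    rw [hθ, hB]
    calc _ ≤ r + r / (m * a) := by linarith
      _ = _ := by ring
  have hu := u_le H (x := x - d1 + d2) (t := t - θ) (Y := Y - d2) ⟨q, by
      convert hw1 using 1
      ext <;> simp <;> linarith, by
      have : ((x - d1 + d2 + (Y - d2), Y - d2) : ℝ × ℝ) = (w1, w2) := by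
        ext <;> simp <;> linarith
      rw [this]; linarith⟩
  have hrB : r ≤ r * B := le_mul_of_one_le_right hr0.le hB1
  have hnorm : ‖((x - d1 + d2, t - θ) : ℝ × ℝ) - (x, t)‖ ≤ r * B := by
    rw [Prod.norm_def]
    refine max_le ?_ ?_
    · simp only [Prod.fst_sub, Real.norm_eq_abs, abs_le]
      constructor <;> linarith
    · simp only [Prod.snd_sub, Real.norm_eq_abs, abs_le]
      constructor <;> linarith
  have hD := hdiff (y := (x - d1 + d2, t - θ)) (by
    rw [dist_eq_norm]; linarith)
  have hD' := hD.trans (mul_le_mul_of_nonneg_left hnorm hη0.le)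
  have hLL : L ((x - d1 + d2, t - θ) - (x, t)) = (d2 - d1) * p + τ * θ := by
    rw [Prod.mk_sub_mk, hLa, hτ]; ring
  rw [hLL, Real.norm_eq_abs, abs_le] at hD'
  simp only [← hv] at hD'
  have hηB : η * (r * B) = (1 - k) * a * r / 4 := by
    rw [hη]; field_simp
  rw [hηB] at hD'
  have hτθ : τ * θ = τ * e + k * ℓ := by
    rw [hθ, hk]; ring
  have hfin : (1 - k) * (a * r) ≤ (1 - k) * ℓ := mul_le_mul_of_nonneg_left hℓ1 hk1.le
  have hpos : 0 < (1 - k) * a * r := by positivity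
  nlinarith [hD'.2]

lemma ae_fst_notMem {S : Set ℝ} (hS : S.Countable) : ∀ᵐ p : ℝ × ℝ, p.1 ∉ S := by
  have h1 : ∀ᵐ x : ℝ, x ∉ S := measure_eq_zero_iff_ae_notMem.1 (hS.measure_zero _)
  exact (Measure.quasiMeasurePreserving_fst (μ := (volume : Measure ℝ))
    (ν := (volume : Measure ℝ))).ae h1

lemma section_null {c : ℝ × ℝ → ℝ} {v₀ : ℝ → ℝ} (H : Hyp c v₀) {a b : ℝ} {f : ℝ → ℝ}
    (hf : ContDiffOn ℝ 1 f (Icc a b))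
    (hf' : ∀ᵐ s ∂volume, s ∈ Ioo a b → deriv f s ∉ Icc (-1 : ℝ) 0) (t : ℝ) :
    volume {x : ℝ | x ∈ Ioo a b ∧ -hydroV c v₀ x t = f x} = 0 := by
  set S := {x : ℝ | x ∈ Ioo a b ∧ -hydroV c v₀ x t = f x} with hS
  have hcount : {x ∈ S | 𝓝[S ∩ Ioi x] x = ⊥}.Countable :=
    countable_setOfPred_isolated_right_within
  rw [measure_eq_zero_iff_ae_notMem]
  filter_upwards [hf', measure_eq_zero_iff_ae_notMem.1 (hcount.measure_zero volume)]
    with x hx1 hx2 hxS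
  refine hx1 hxS.1 ?_
  have hne : (𝓝[S ∩ Ioi x] x).NeBot := ⟨fun h => hx2 ⟨hxS, h⟩⟩
  have hd : DifferentiableAt ℝ f x :=
    (hf.differentiableOn one_ne_zero).differentiableAt (Icc_mem_nhds hxS.1.1 hxS.1.2)
  have hs := hd.hasDerivAt.tendsto_slope.mono_left
    (nhdsWithin_mono x (show S ∩ Ioi x ⊆ {x}ᶜ from fun y hy => ne_of_gt hy.2))
  refine isClosed_Icc.mem_of_tendsto hs ?_
  filter_upwards [self_mem_nhdsWithin] with y hy
  have hxy : x < y := hy.2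
  have e1 := hy.1.2
  have e2 := hxS.2
  have h1 := u_anti_x H t hxy.le
  have h2 := u_lip_x H t hxy.le
  rw [slope_def_field, ← e1, ← e2]
  have : 0 < y - x := by linarith
  exact ⟨by rw [le_div_iff₀ this]; linarith, by rw [div_le_iff₀ this]; linarith⟩

lemma graph_null {c : ℝ × ℝ → ℝ} {v₀ : ℝ → ℝ} (H : Hyp c v₀) {a b : ℝ} {f : ℝ → ℝ}
    (hf : ContDiffOn ℝ 1 f (Icc a b))
    (hf' : ∀ᵐ s ∂volume, s ∈ Ioo a b → deriv f s ∉ Icc (-1 : ℝ) 0) :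
    ∀ᵐ p : ℝ × ℝ, ¬ (p.1 ∈ Icc a b ∧ -hydroV c v₀ p.1 p.2 = f p.1) := by
  set O : Set (ℝ × ℝ) := Prod.fst ⁻¹' Ioo a b with hO
  have hOo : IsOpen O := isOpen_Ioo.preimage continuous_fst
  set g : ℝ × ℝ → ℝ := fun p => -hydroV c v₀ p.1 p.2 - f p.1 with hg
  have hgc : ContinuousOn g O := by
    refine (v_cont H).neg.continuousOn.sub ?_
    exact hf.continuousOn.comp continuous_fst.continuousOn fun p hp => Ioo_subset_Icc_self hp
  have ho := hgc.isOpen_inter_preimage hOo (isOpen_compl_singleton (x := (0:ℝ)))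
  set E : Set (ℝ × ℝ) := O \ (O ∩ g ⁻¹' {0}ᶜ) with hE
  have hEm : MeasurableSet E := hOo.measurableSet.diff ho.measurableSet
  have hmem : ∀ p : ℝ × ℝ, p ∈ E ↔ p.1 ∈ Ioo a b ∧ -hydroV c v₀ p.1 p.2 = f p.1 := by
    intro p
    constructor
    · rintro ⟨h1, h2⟩
      refine ⟨h1, ?_⟩
      by_contra h3
      exact h2 ⟨h1, fun h4 => h3 (sub_eq_zero.1 h4)⟩
    · rintro ⟨h1, h2⟩
      exact ⟨h1, fun h3 => h3.2 (sub_eq_zero.2 h2)⟩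
  have hE0 : volume E = 0 := by
    rw [Measure.volume_eq_prod, Measure.prod_apply_symm hEm]
    have : ∀ t : ℝ, volume ((fun x : ℝ => (x, t)) ⁻¹' E) = 0 := by
      intro t
      have : (fun x : ℝ => (x, t)) ⁻¹' E = {x : ℝ | x ∈ Ioo a b ∧ -hydroV c v₀ x t = f x} := by
        ext x
        exact hmem (x, t)
      rw [this]
      exact section_null H hf hf' t
    simp [this]
  filter_upwards [measure_eq_zero_iff_ae_notMem.1 hE0,
    ae_fst_notMem (S := {a, b}) (by simp)] with p hp1 hp2 hp3
  simp only [mem_insert_iff, mem_singleton_iff, not_or] at hp2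
  exact hp1 ((hmem p).2 ⟨⟨lt_of_le_of_ne hp3.1.1 (Ne.symm hp2.1), lt_of_le_of_ne hp3.1.2 hp2.2⟩,
    hp3.2⟩)

lemma ae_cont {c : ℝ × ℝ → ℝ} {v₀ : ℝ → ℝ} (H : Hyp c v₀)
    (hA : Assumption210 (fun z : ℝ × ℝ => c (z.1 + z.2, z.2))) :
    ∀ᵐ p : ℝ × ℝ, ContinuousAt (fun z : ℝ × ℝ => c (z.1 + z.2, z.2))
      (p.1, -hydroV c v₀ p.1 p.2) := by
  have : ∀ n : ℕ, ∀ᵐ p : ℝ × ℝ, (p.1, -hydroV c v₀ p.1 p.2) ∈ Metric.closedBall (0 : ℝ × ℝ) n →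
      ContinuousAt (fun z : ℝ × ℝ => c (z.1 + z.2, z.2)) (p.1, -hydroV c v₀ p.1 p.2) := by
    intro n
    obtain ⟨k, aa, bb, f, m, xs, ya, yb, P, h1, h2, h3, h4⟩ :=
      hA (Metric.closedBall 0 n) (isCompact_closedBall _ _)
    filter_upwards [ae_all_iff.2 fun i => graph_null H (h1 i) (h2 i),
      ae_fst_notMem (countable_range xs), ae_fst_notMem (h3.image Prod.fst)] with p q1 q2 q3 q4
    by_contra hcon
    rcases h4 ⟨q4, hcon⟩ with (h | h) | h
    · obtain ⟨i, hi⟩ := mem_iUnion.1 h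
      exact q1 i hi
    · obtain ⟨j, hj⟩ := mem_iUnion.1 h
      exact q2 ⟨j, hj.1.symm⟩
    · exact q3 ⟨_, h, rfl⟩
  filter_upwards [ae_all_iff.2 this] with p hp
  obtain ⟨n, hn⟩ := exists_nat_ge ‖((p.1, -hydroV c v₀ p.1 p.2) : ℝ × ℝ)‖
  exact hp n (by simpa using hn)

lemma part1 {c : ℝ × ℝ → ℝ} {v₀ : ℝ → ℝ} (H : Hyp c v₀) (hlsc : LowerSemicontinuous c)
    {x t : ℝ} (ht : 0 < t) {L : ℝ × ℝ →L[ℝ] ℝ}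
    (hF : HasFDerivAt (fun p : ℝ × ℝ => hydroV c v₀ p.1 p.2) L (x, t))
    (hC : ContinuousAt (fun p : ℝ × ℝ =>
        c (p.1 + -(hydroV c v₀ p.1 p.2), -(hydroV c v₀ p.1 p.2))) (x, t)) :
    L (0, 1) + c (x + -(hydroV c v₀ x t), -(hydroV c v₀ x t)) *
        L (1, 0) * (1 - L (1, 0)) = 0 := by
  have h1 := dir1 H hF hC
  have h2 := dir2 H hlsc ht hF
  linarith

/-- Strong solution at good points: the limiting current `v` solves
`v_t + c̃(x,−v) v_x (1−v_x) = 0` at every point of differentiability of `v` at which the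
sampled coefficient `c̃(x,−v(x,t))` is continuous (here `c̃(x,y) = c(x+y,y)`); and under
Assumption 2.10 almost every point of `ℝ × (0,∞)` is such a point, so `v` is an
almost-everywhere classical solution. -/
theorem stmt_15 (c : ℝ × ℝ → ℝ) (hc : SpeedAssumptions c) (hgr : SublogGrowth c)
    (v₀ : ℝ → ℝ) (hmono : Monotone v₀) (hlip : LipschitzWith 1 v₀) :
    (∀ (x t : ℝ) (L : ℝ × ℝ →L[ℝ] ℝ), 0 < t →
      HasFDerivAt (fun p : ℝ × ℝ => hydroV c v₀ p.1 p.2) L (x, t) →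
      ContinuousAt (fun p : ℝ × ℝ =>
        c (p.1 + -(hydroV c v₀ p.1 p.2), -(hydroV c v₀ p.1 p.2))) (x, t) →
      L (0, 1) + c (x + -(hydroV c v₀ x t), -(hydroV c v₀ x t)) *
        L (1, 0) * (1 - L (1, 0)) = 0) ∧
    (Assumption210 (fun z : ℝ × ℝ => c (z.1 + z.2, z.2)) →
      ∀ᵐ p : ℝ × ℝ ∂volume, 0 < p.2 →
        ∃ L : ℝ × ℝ →L[ℝ] ℝ,
          HasFDerivAt (fun q : ℝ × ℝ => hydroV c v₀ q.1 q.2) L p ∧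
          ContinuousAt (fun q : ℝ × ℝ =>
            c (q.1 + -(hydroV c v₀ q.1 q.2), -(hydroV c v₀ q.1 q.2))) p ∧
          L (0, 1) + c (p.1 + -(hydroV c v₀ p.1 p.2), -(hydroV c v₀ p.1 p.2)) *
            L (1, 0) * (1 - L (1, 0)) = 0) := by
  have H : Hyp c v₀ := ⟨hc.1.measurable, hc.2.1, hc.2.2.1, hgr, hmono, hlip⟩
  refine ⟨fun x t L ht hF hC => part1 H hc.1 ht hF hC, fun hA => ?_⟩
  filter_upwards [v_ae_diff H, ae_cont H hA] with p hp1 hp2 hp0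
  have hC : ContinuousAt (fun q : ℝ × ℝ =>
      c (q.1 + -(hydroV c v₀ q.1 q.2), -(hydroV c v₀ q.1 q.2))) p := by
    have hcv : ContinuousAt (fun q : ℝ × ℝ => (q.1, -hydroV c v₀ q.1 q.2)) p :=
      (continuous_fst.prodMk (v_cont H).neg).continuousAt
    exact ContinuousAt.comp (f := fun q : ℝ × ℝ => (q.1, -hydroV c v₀ q.1 q.2)) hp2 hcv
  exact ⟨_, hp1.hasFDerivAt, hC, part1 H hc.1 hp0 hp1.hasFDerivAt hC⟩
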